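/- Local quadratic upper bound on vertical lines through the saddle points (part of Lemma 3.2): Fix an integer M ≥ 1 and φ0 ∈ (0, π/(M+1)); set w_+ = ζ(φ0) and w_− = conj(ζ(φ0)). Then there exist ε > 0 and δ > 0 such that for every real a > 0 and every real y with |y − Im w_+| ≤ δ, Re F̂(Re w_+ + iy; a) ≤ Re F̂(w_+; a) − ε·(y − Im w_+)², and for every real y with |y − Im w_−| ≤ δ, Re F̂(Re w_+ + iy; a) ≤ Re F̂(w_−; a) − ε·(y − Im w_−)². -/

import Mathlib

open Complex Real Set Filter

/-- The phase function `F̂(z; a)` (principal branch of `log`). -/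
noncomputable def Fhat (M : ℕ) (z : ℂ) (a : ℝ) : ℂ :=
  ((M : ℂ) + 1) * z * (Complex.log z - 1) - (z - 1) * (Complex.log (z - 1) - 1) -
    z * (Real.log a : ℂ)

/-- The parametrization `ζ(φ)` of the steepest ascent curve. -/
noncomputable def zeta (M : ℕ) (φ : ℝ) : ℂ :=
  ((Real.sin ((M + 1) * φ) / Real.sin (M * φ) : ℝ) : ℂ) * Complex.exp ((φ : ℂ) * Complex.I)

/-- The parametrization `v(φ)` of the spectral variable. -/
noncomputable def v (M : ℕ) (φ : ℝ) : ℝ :=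
  Real.sin ((M + 1) * φ) ^ (M + 1) / (Real.sin φ * Real.sin (M * φ) ^ M)

theorem abs_sin_natCast_mul_lt {θ : ℝ} (h0 : 0 < θ) (h1 : θ < Real.pi) {n : ℕ} (hn : 2 ≤ n) :
    |Real.sin (n * θ)| < n * Real.sin θ := by
  have hs : 0 < Real.sin θ := Real.sin_pos_of_pos_of_lt_pi h0 h1
  induction n, hn using Nat.le_induction with
  | base =>
    have hc : |Real.cos θ| < 1 := by
      rw [← sq_lt_one_iff_abs_lt_one]
      nlinarith [Real.sin_sq_add_cos_sq θ]
    rw [Nat.cast_ofNat, Real.sin_two_mul, abs_mul, abs_mul, abs_of_pos hs, abs_two]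
    nlinarith
  | succ n _ ih =>
    have e : ((n + 1 : ℕ) : ℝ) * θ = n * θ + θ := by push_cast; ring
    rw [e, Real.sin_add]
    refine (abs_add_le _ _).trans_lt ?_
    rw [abs_mul, abs_mul, abs_of_pos hs]
    push_cast
    nlinarith [Real.abs_cos_le_one θ, Real.abs_cos_le_one (n * θ), abs_nonneg (Real.sin (n * θ))]

/-- Second-order Taylor bound: a critical point with negative second derivative has a quadratic
upper bound nearby. -/
theorem exists_eventually_le_sub_sq {f f' : ℝ → ℝ} {m x₀ : ℝ}
    (hf : ∀ᶠ x in nhds x₀, HasDerivAt f (f' x) x) (h0 : f' x₀ = 0) (hf' : HasDerivAt f' m x₀)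
    (hm : m < 0) : ∃ ε > 0, ∀ᶠ x in nhds x₀, f x ≤ f x₀ - ε * (x - x₀) ^ 2 := by
  refine ⟨-m / 4, by linarith, ?_⟩
  have hd : ∀ᶠ x in nhds x₀, HasDerivAt (fun x => f x + -m / 4 * (x - x₀) ^ 2)
      (f' x + -m / 2 * (x - x₀)) x := by
    filter_upwards [hf] with x hx
    refine (hx.add ((((hasDerivAt_id x).sub_const x₀).pow 2).const_mul (-m / 4))).congr_deriv ?_
    simp only [id]
    ring
  have hd2 : HasDerivAt (fun x => f' x + -m / 2 * (x - x₀)) (m / 2) x₀ := by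
    refine (hf'.add (((hasDerivAt_id x₀).sub_const x₀).const_mul (-m / 2))).congr_deriv ?_
    ring
  have heq : deriv (fun x => f x + -m / 4 * (x - x₀) ^ 2) =ᶠ[nhds x₀]
      fun x => f' x + -m / 2 * (x - x₀) := hd.mono fun x hx => hx.deriv
  have hmax : IsLocalMax (fun x => f x + -m / 4 * (x - x₀) ^ 2) x₀ := by
    apply isLocalMax_of_deriv_deriv_neg
    · rw [heq.deriv_eq, hd2.deriv]
      linarith
    · rw [heq.eq_of_nhds]
      simp [h0]
    · exact hd.self_of_nhds.continuousAt
  filter_upwards [hmax] with x hx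
  simp only [sub_self] at hx
  linarith

theorem Fhat_re_eq (M : ℕ) (z : ℂ) (a : ℝ) :
    (Fhat M z a).re = (Fhat M z 1).re - z.re * Real.log a := by
  simp [Fhat]

theorem Fhat_conj_re (M : ℕ) (z : ℂ) (a : ℝ) :
    (Fhat M ((starRingEnd ℂ) z) a).re = (Fhat M z a).re := by
  by_cases hz : z.im = 0
  · rw [Complex.conj_eq_iff_im.2 hz]
  · have h1 : z.arg ≠ Real.pi := fun h => hz (Complex.arg_eq_pi_iff.1 h).2
    have h2 : (z - 1).arg ≠ Real.pi := fun h => hz (by simpa using (Complex.arg_eq_pi_iff.1 h).2)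
    have e : Fhat M ((starRingEnd ℂ) z) a = (starRingEnd ℂ) (Fhat M z a) := by
      have e2 : Complex.log ((starRingEnd ℂ) z - 1) = (starRingEnd ℂ) (Complex.log (z - 1)) := by
        rw [← Complex.log_conj _ h2, map_sub, map_one]
      simp only [Fhat, map_sub, map_mul, map_add, map_one, map_natCast, Complex.conj_ofReal,
        Complex.log_conj _ h1, e2]
    rw [e, Complex.conj_re]

theorem hasDerivAt_Fhat (M : ℕ) (a : ℝ) {z : ℂ} (hz : z.im ≠ 0) :
    HasDerivAt (fun z => Fhat M z a)
      ((M + 1) * Complex.log z - Complex.log (z - 1) - (Real.log a : ℂ)) z := by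
  have hw : (z - 1).im ≠ 0 := by simpa using hz
  have hz0 : z ≠ 0 := fun h => hz (by simp [h])
  have hw0 : z - 1 ≠ 0 := fun h => hw (by simp [h])
  have h1 := (Complex.hasDerivAt_log (Or.inr hz)).sub_const 1
  have hs := (hasDerivAt_id z).sub_const (1 : ℂ)
  have h2 := (hs.clog (Or.inr hw)).sub_const 1
  have h3 := ((((hasDerivAt_id z).const_mul ((M : ℂ) + 1)).mul h1).sub (hs.mul h2)).sub
    ((hasDerivAt_id z).mul_const (Real.log a : ℂ))
  refine h3.congr_deriv ?_
  simp only [id]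
  field_simp
  ring

theorem hasDerivAt_verticalLine (x y : ℝ) :
    HasDerivAt (fun y : ℝ => (x : ℂ) + (y : ℂ) * Complex.I) Complex.I y := by
  simpa using ((Complex.ofRealCLM.hasDerivAt (x := y)).mul_const Complex.I).const_add (x : ℂ)

theorem hasDerivAt_Fhat_re_verticalLine (M : ℕ) (x : ℝ) {y : ℝ} (hy : y ≠ 0) :
    HasDerivAt (fun y : ℝ => (Fhat M ((x : ℂ) + (y : ℂ) * Complex.I) 1).re)
      ((Complex.log ((x : ℂ) + (y : ℂ) * Complex.I - 1)).im -
        (M + 1) * (Complex.log ((x : ℂ) + (y : ℂ) * Complex.I)).im) y := by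
  have hz : ((x : ℂ) + (y : ℂ) * Complex.I).im ≠ 0 := by simpa using hy
  have h := (hasDerivAt_Fhat M 1 hz).comp y (hasDerivAt_verticalLine x y)
  refine (Complex.reCLM.hasFDerivAt.comp_hasDerivAt y h).congr_deriv ?_
  simp

theorem hasDerivAt_log_im_verticalLine (M : ℕ) (x : ℝ) {y : ℝ} (hy : y ≠ 0) :
    HasDerivAt (fun y : ℝ => (Complex.log ((x : ℂ) + (y : ℂ) * Complex.I - 1)).im -
        (M + 1) * (Complex.log ((x : ℂ) + (y : ℂ) * Complex.I)).im)
      (((x : ℂ) + (y : ℂ) * Complex.I - 1)⁻¹.re -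
        (M + 1) * ((x : ℂ) + (y : ℂ) * Complex.I)⁻¹.re) y := by
  have hz : ((x : ℂ) + (y : ℂ) * Complex.I).im ≠ 0 := by simpa using hy
  have hw : ((x : ℂ) + (y : ℂ) * Complex.I - 1).im ≠ 0 := by simpa using hy
  have h1 := Complex.imCLM.hasFDerivAt.comp_hasDerivAt y
    (((hasDerivAt_verticalLine x y).sub_const 1).clog_real (Or.inr hw))
  have h2 := Complex.imCLM.hasFDerivAt.comp_hasDerivAt y
    ((hasDerivAt_verticalLine x y).clog_real (Or.inr hz))
  refine (h1.sub (h2.const_mul ((M : ℝ) + 1))).congr_deriv ?_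
  simp [div_eq_mul_inv]

theorem zeta_sub_one {M : ℕ} {φ : ℝ} (h : Real.sin (M * φ) ≠ 0) :
    zeta M φ - 1 = ((Real.sin φ / Real.sin (M * φ) : ℝ) : ℂ) *
      Complex.exp ((((M + 1) * φ : ℝ) : ℂ) * Complex.I) := by
  have e : ((M : ℝ) + 1) * φ = M * φ + φ := by ring
  have hp := Real.sin_sq_add_cos_sq φ
  apply Complex.ext
  · simp only [zeta, e, Real.sin_add, Real.cos_add, Complex.sub_re, Complex.re_ofReal_mul,
      Complex.exp_ofReal_mul_I_re, Complex.one_re]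
    field_simp
    linear_combination (Real.sin (M * φ)) * hp
  · simp only [zeta, e, Real.sin_add, Complex.sub_im, Complex.im_ofReal_mul,
      Complex.exp_ofReal_mul_I_im, Complex.one_im]
    field_simp
    ring

theorem log_im_ofReal_mul_exp {r θ : ℝ} (hr : 0 < r) (h0 : 0 < θ) (h1 : θ < Real.pi) :
    (Complex.log ((r : ℂ) * Complex.exp ((θ : ℂ) * Complex.I))).im = θ := by
  rw [Complex.log_im, Complex.exp_mul_I, Complex.arg_mul_cos_add_sin_mul_I hr ⟨by linarith, h1.le⟩]

theorem inv_ofReal_mul_exp_re (r θ : ℝ) :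
    ((r : ℂ) * Complex.exp ((θ : ℂ) * Complex.I))⁻¹.re = Real.cos θ / r := by
  have : ((r : ℂ) * Complex.exp ((θ : ℂ) * Complex.I))⁻¹ =
      ((r⁻¹ : ℝ) : ℂ) * Complex.exp (((-θ : ℝ) : ℂ) * Complex.I) := by
    rw [mul_inv, ← Complex.exp_neg]
    push_cast
    ring_nf
  rw [this, Complex.re_ofReal_mul, Complex.exp_ofReal_mul_I_re, Real.cos_neg]
  ring

/-- Local quadratic upper bound on vertical lines through the saddle points
(part of Lemma 3.2). -/
theorem local_quadratic_upper_bound_on_vertical_line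
    (M : ℕ) (hM : 1 ≤ M)
    (φ0 : ℝ) (hφ0 : φ0 ∈ Set.Ioo (0 : ℝ) (Real.pi / ((M : ℝ) + 1))) :
    ∃ ε > (0 : ℝ), ∃ δ > (0 : ℝ), ∀ a : ℝ, 0 < a → ∀ y : ℝ,
      (|y - (zeta M φ0).im| ≤ δ →
        (Fhat M (((zeta M φ0).re : ℂ) + (y : ℂ) * Complex.I) a).re ≤
          (Fhat M (zeta M φ0) a).re - ε * (y - (zeta M φ0).im) ^ 2) ∧
      (|y - ((starRingEnd ℂ) (zeta M φ0)).im| ≤ δ →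
        (Fhat M (((zeta M φ0).re : ℂ) + (y : ℂ) * Complex.I) a).re ≤
          (Fhat M ((starRingEnd ℂ) (zeta M φ0)) a).re -
            ε * (y - ((starRingEnd ℂ) (zeta M φ0)).im) ^ 2) := by
  obtain ⟨hφ, hφ'⟩ := hφ0
  have hM1 : (1 : ℝ) ≤ M := by exact_mod_cast hM
  have hNφ : ((M : ℝ) + 1) * φ0 < Real.pi := by
    rw [lt_div_iff₀ (by positivity)] at hφ'
    linarith
  have hs1 : 0 < Real.sin φ0 := Real.sin_pos_of_pos_of_lt_pi hφ (by nlinarith)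
  have hsM : 0 < Real.sin (M * φ0) := Real.sin_pos_of_pos_of_lt_pi (by positivity) (by nlinarith)
  have hsN : 0 < Real.sin ((M + 1) * φ0) := Real.sin_pos_of_pos_of_lt_pi (by positivity) hNφ
  have him : 0 < (zeta M φ0).im := by
    rw [zeta, Complex.im_ofReal_mul, Complex.exp_ofReal_mul_I_im]
    positivity
  have hcrit : (Complex.log (zeta M φ0 - 1)).im - (M + 1) * (Complex.log (zeta M φ0)).im = 0 := by
    rw [zeta_sub_one hsM.ne', log_im_ofReal_mul_exp (by positivity) (by positivity) hNφ, zeta,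
      log_im_ofReal_mul_exp (by positivity) hφ (by nlinarith), sub_self]
  have hneg : (zeta M φ0 - 1)⁻¹.re - (M + 1) * (zeta M φ0)⁻¹.re < 0 := by
    rw [zeta_sub_one hsM.ne', zeta, inv_ofReal_mul_exp_re, inv_ofReal_mul_exp_re]
    have key := (le_abs_self _).trans_lt (abs_sin_natCast_mul_lt (θ := 2 * φ0) (by positivity)
      (by nlinarith) (n := M + 1) (by omega))
    have e : ((M + 1 : ℕ) : ℝ) * (2 * φ0) = 2 * ((M + 1) * φ0) := by push_cast; ring
    rw [e, Real.sin_two_mul, Real.sin_two_mul] at key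
    push_cast at key
    rw [sub_neg, div_div_eq_mul_div, div_div_eq_mul_div, mul_div_assoc', div_lt_div_iff₀ hs1 hsN]
    nlinarith
  have hz : ((zeta M φ0).re : ℂ) + ((zeta M φ0).im : ℂ) * Complex.I = zeta M φ0 :=
    Complex.re_add_im _
  obtain ⟨ε, hε, h⟩ := exists_eventually_le_sub_sq
    ((eventually_ne_nhds him.ne').mono fun y hy =>
      hasDerivAt_Fhat_re_verticalLine M (zeta M φ0).re hy)
    (by rw [hz]; exact hcrit) (hasDerivAt_log_im_verticalLine M (zeta M φ0).re him.ne')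
    (by rw [hz]; exact hneg)
  obtain ⟨δ, hδ, hb⟩ := Metric.nhds_basis_closedBall.eventually_iff.1 h
  have main : ∀ a y : ℝ, |y - (zeta M φ0).im| ≤ δ →
      (Fhat M (((zeta M φ0).re : ℂ) + (y : ℂ) * Complex.I) a).re ≤
        (Fhat M (zeta M φ0) a).re - ε * (y - (zeta M φ0).im) ^ 2 := by
    intro a y hy
    have := hb (x := y) (by rwa [Metric.mem_closedBall, Real.dist_eq])
    rw [hz] at this
    rw [Fhat_re_eq, Fhat_re_eq M (zeta M φ0)]
    have hre : (((zeta M φ0).re : ℂ) + (y : ℂ) * Complex.I).re = (zeta M φ0).re := by simp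
    rw [hre]
    linarith
  refine ⟨ε, hε, δ, hδ, fun a _ y => ⟨main a y, fun hy => ?_⟩⟩
  rw [Complex.conj_im] at hy ⊢
  have hy' : |-y - (zeta M φ0).im| ≤ δ := by
    rw [← abs_neg]
    convert hy using 2
    ring
  have hconj : ((zeta M φ0).re : ℂ) + (y : ℂ) * Complex.I =
      (starRingEnd ℂ) (((zeta M φ0).re : ℂ) + ((-y : ℝ) : ℂ) * Complex.I) := by
    apply Complex.ext <;> simp
  rw [hconj, Fhat_conj_re, Fhat_conj_re]
  refine (main a (-y) hy').trans_eq ?_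
  ring
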